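/- Let λ₁, λ₂ be coprime positive integers and S = {0, λ₁, λ₁+λ₂}. Then d_f(S,-S) = d_f(S) = max( ⌊(2/3)(λ₁+2λ₂)⌋/(λ₁+2λ₂), ⌊(2/3)(2λ₁+λ₂)⌋/(2λ₁+λ₂) ). -/

import Mathlib

open Filter Set

/-- The translateSet `S + t` of a set of integers. -/
def translateSet (S : Set ℤ) (t : ℤ) : Set ℤ := (· + t) '' S

/-- Upper density of a set of integers. -/
noncomputable def upperDensity (A : Set ℤ) : ℝ :=
  Filter.limsup (fun n : ℕ => ((A ∩ Set.Icc (-(n : ℤ)) (n : ℤ)).ncard : ℝ) / (2 * n + 1)) Filter.atTop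

/-- Lower density of a set of integers. -/
noncomputable def lowerDensity (A : Set ℤ) : ℝ :=
  Filter.liminf (fun n : ℕ => ((A ∩ Set.Icc (-(n : ℤ)) (n : ℤ)).ncard : ℝ) / (2 * n + 1)) Filter.atTop

/-- `A` is `S`-covering: every integer lies in some translateSet `S + a`, `a ∈ A`. -/
def SCovering (S A : Set ℤ) : Prop := ∀ t : ℤ, ∃ a ∈ A, t ∈ translateSet S a

/-- `A` is `S`-blocking: `A` meets every translateSet of `S`. -/
def SBlocking (S A : Set ℤ) : Prop := ∀ t : ℤ, (A ∩ translateSet S t).Nonempty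

/-- `A` is `S`-free: `A` contains no translateSet of `S`. -/
def SFree (S A : Set ℤ) : Prop := ∀ t : ℤ, ¬ translateSet S t ⊆ A

/-- `A` is `S`-packing: distinct translates `S + a₁`, `S + a₂` with `a₁, a₂ ∈ A` are disjoint. -/
def SPacking (S A : Set ℤ) : Prop :=
  ∀ a₁ ∈ A, ∀ a₂ ∈ A, a₁ ≠ a₂ → Disjoint (translateSet S a₁) (translateSet S a₂)

/-- Maximum packing density of `S`. -/
noncomputable def dP (S : Set ℤ) : ℝ := sSup (upperDensity '' {A | SPacking S A})

/-- Minimum covering density of `S`. -/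
noncomputable def dC (S : Set ℤ) : ℝ := sInf (lowerDensity '' {A | SCovering S A})

/-- Minimum blocking density of `S`. -/
noncomputable def dB (S : Set ℤ) : ℝ := sInf (lowerDensity '' {A | SBlocking S A})

/-- `d_f(S)`: supremum of upper densities of `S`-free sets. -/
noncomputable def dF (S : Set ℤ) : ℝ := sSup (upperDensity '' {A | SFree S A})

/-- `d_f(S, -S)`: supremum of upper densities of sets free of translates of both `S` and `-S`. -/
noncomputable def dF2 (S : Set ℤ) : ℝ := sSup (upperDensity '' {A | SFree S A ∧ SFree (-S) A})


theorem exists_antidifference (g : ℤ → ℤ) : ∃ G : ℤ → ℤ, ∀ x, G x - G (x - 1) = g x := by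
  refine ⟨fun x => ∑ i ∈ Finset.Ioc 0 x, g i - ∑ i ∈ Finset.Ioc x 0, g i, fun x => ?_⟩
  rcases lt_or_ge 0 x with hx | hx
  · have h : Finset.Ioc 0 x = insert x (Finset.Ioc 0 (x - 1)) := by
      ext i; simp only [Finset.mem_Ioc, Finset.mem_insert]; omega
    simp [h, Finset.Ioc_eq_empty_of_le hx.le, Finset.Ioc_eq_empty_of_le (show 0 ≤ x - 1 by omega)]
  · have h : Finset.Ioc (x - 1) 0 = insert x (Finset.Ioc x 0) := by
      ext i; simp only [Finset.mem_Ioc, Finset.mem_insert]; omega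
    simp [h, Finset.Ioc_eq_empty_of_le hx, Finset.Ioc_eq_empty_of_le (show x - 1 ≤ 0 by omega)]

theorem sum_range_antidifference {G g : ℤ → ℤ} (h : ∀ x, G x - G (x - 1) = g x) (c : ℕ) (z : ℤ) :
    ∑ i ∈ Finset.range c, g (z - i) = G z - G (z - c) := by
  induction c with
  | zero => simp
  | succ c ih =>
    rw [Finset.sum_range_succ, ih, ← h]
    push_cast
    rw [show z - (c : ℤ) - 1 = z - (c + 1) by ring]
    ring

/-- Indicator that `f` vanishes at the first vertex only of a triangle with values `p, q, r`. -/
def onlyFirst (p q r : ℤ) : ℤ := (1 - p) * q * r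

/-- Indicator that three `0/1` values agree. -/
def mono (p q r : ℤ) : ℤ := p * q * r + (1 - p) * (1 - q) * (1 - r)

theorem weighted_cut_bound (f : ℤ → ℤ) (a b : ℕ) (hab : ((a : ℤ) - b) % 3 = 1)
    (h01 : ∀ x, f x = 0 ∨ f x = 1) (hit : ∀ x, 1 ≤ f x + f (x + a) + f (x + a + b)) (y : ℤ) :
    2 ≤ 2 * (∑ i ∈ Finset.range (2 * a + b),
            onlyFirst (f (y - i)) (f (y - i + a)) (f (y - i + a + b))
          + ∑ i ∈ Finset.range b, onlyFirst (f (y - i + a)) (f (y - i)) (f (y - i + a + b))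
          + ∑ i ∈ Finset.range (2 * a),
            f (y - b - i) * f (y - b - i + a) * f (y - b - i + a + b)
          + ∑ i ∈ Finset.range b, mono (f (y - i)) (f (y - i + b)) (f (y - i + a + b)))
        + (∑ i ∈ Finset.range a, onlyFirst (f (y - i + a)) (f (y - i)) (f (y - i + a + b))
          + ∑ i ∈ Finset.range (a + 2 * b),
            onlyFirst (f (y + b - i + a + b)) (f (y + b - i)) (f (y + b - i + a))
          + ∑ i ∈ Finset.range (2 * b),
            f (y + b - i) * f (y + b - i + a) * f (y + b - i + a + b)
          + ∑ i ∈ Finset.range a,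
            mono (f (y - b - i)) (f (y - b - i + b)) (f (y - b - i + a + b))) := by
  obtain ⟨F, hF⟩ := exists_antidifference f
  obtain ⟨Qa, hQa⟩ := exists_antidifference fun x => f x * f (x + a)
  obtain ⟨Qb, hQb⟩ := exists_antidifference fun x => f x * f (x + b)
  obtain ⟨Qc, hQc⟩ := exists_antidifference fun x => f x * f (x + a + b)
  have hB : ∀ x, f x * f (x + a) * f (x + a + b) = 1 - f x - f (x + a) - f (x + a + b)
      + f x * f (x + a) + f (x + a) * f (x + a + b) + f x * f (x + a + b) := by
    intro x
    have := hit x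
    rcases h01 x with h | h <;> rcases h01 (x + a) with h' | h' <;>
      rcases h01 (x + a + b) with h'' | h'' <;> simp [h, h', h''] at this ⊢
  let GB : ℤ → ℤ := fun x => x - F x - F (x + a) - F (x + a + b) + Qa x + Qb (x + a) + Qc x
  let GD : ℤ → ℤ := fun x => x - F x - F (x + b) - F (x + a + b) + Qb x + Qa (x + b) + Qc x
  have stepFa := fun x => hF (x + a)
  have stepFab := fun x => hF (x + a + b)
  have stepFb := fun x => hF (x + b)
  have dQb := fun x => hQb (x + a)
  have dQa := fun x => hQa (x + b)
  simp only [show ∀ x : ℤ, x + a - 1 = x - 1 + a by intro x; ring,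
    show ∀ x : ℤ, x + b - 1 = x - 1 + b by intro x; ring] at stepFa stepFab stepFb dQa dQb
  have hGB : ∀ x, GB x - GB (x - 1) = f x * f (x + a) * f (x + a + b) := by
    intro x
    have := hB x
    simp only [GB]
    linarith [hF x, stepFa x, stepFab x, hQa x, dQb x, hQc x]
  have hGD : ∀ x, GD x - GD (x - 1) = mono (f x) (f (x + b)) (f (x + a + b)) := by
    intro x
    have e := dQa x
    rw [show x + (b : ℤ) + a = x + a + b by ring] at e
    simp only [GD, mono]
    linarith [hF x, stepFb x, stepFab x, hQb x, e, hQc x]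
  have hA0 : ∀ x, (fun x => Qb (x + a) - GB x) x - (fun x => Qb (x + a) - GB x) (x - 1)
      = onlyFirst (f x) (f (x + a)) (f (x + a + b)) := by
    intro x
    simp only [onlyFirst]
    linarith [hGB x, dQb x]
  have hA1 : ∀ x, (fun x => Qc x - GB x) x - (fun x => Qc x - GB x) (x - 1)
      = onlyFirst (f (x + a)) (f x) (f (x + a + b)) := by
    intro x
    simp only [onlyFirst]
    linarith [hGB x, hQc x]
  have hA2 : ∀ x, (fun x => Qa x - GB x) x - (fun x => Qa x - GB x) (x - 1)
      = onlyFirst (f (x + a + b)) (f x) (f (x + a)) := by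
    intro x
    simp only [onlyFirst]
    linarith [hGB x, hQa x]
  have n0 : ∀ p q r : ℤ, (p = 0 ∨ p = 1) → (q = 0 ∨ q = 1) → (r = 0 ∨ r = 1) →
      0 ≤ onlyFirst p q r ∧ 0 ≤ mono p q r ∧ 0 ≤ p * q * r := by
    rintro p q r (rfl | rfl) (rfl | rfl) (rfl | rfl) <;> simp [onlyFirst, mono]
  have s1 := sum_range_antidifference hA0 (2 * a + b) y
  have s2 := sum_range_antidifference hA1 b y
  have s3 := sum_range_antidifference hGB (2 * a) (y - b)
  have s4 := sum_range_antidifference hGD b y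
  have s5 := sum_range_antidifference hA1 a y
  have s6 := sum_range_antidifference hA2 (a + 2 * b) (y + b)
  have s7 := sum_range_antidifference hGB (2 * b) (y + b)
  have s8 := sum_range_antidifference hGD a (y - b)
  have p1 := Finset.sum_nonneg fun i (_ : i ∈ Finset.range (2 * a + b)) =>
    (n0 _ _ _ (h01 (y - i)) (h01 (y - i + a)) (h01 (y - i + a + b))).1
  have p2 := Finset.sum_nonneg fun i (_ : i ∈ Finset.range b) =>
    (n0 _ _ _ (h01 (y - i + a)) (h01 (y - i)) (h01 (y - i + a + b))).1
  have p3 := Finset.sum_nonneg fun i (_ : i ∈ Finset.range (2 * a)) =>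
    (n0 _ _ _ (h01 (y - b - i)) (h01 (y - b - i + a)) (h01 (y - b - i + a + b))).2.2
  have p4 := Finset.sum_nonneg fun i (_ : i ∈ Finset.range b) =>
    (n0 _ _ _ (h01 (y - i)) (h01 (y - i + b)) (h01 (y - i + a + b))).2.1
  have p5 := Finset.sum_nonneg fun i (_ : i ∈ Finset.range a) =>
    (n0 _ _ _ (h01 (y - i + a)) (h01 (y - i)) (h01 (y - i + a + b))).1
  have p6 := Finset.sum_nonneg fun i (_ : i ∈ Finset.range (a + 2 * b)) =>
    (n0 _ _ _ (h01 (y + b - i + a + b)) (h01 (y + b - i)) (h01 (y + b - i + a))).1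
  have p7 := Finset.sum_nonneg fun i (_ : i ∈ Finset.range (2 * b)) =>
    (n0 _ _ _ (h01 (y + b - i)) (h01 (y + b - i + a)) (h01 (y + b - i + a + b))).2.2
  have p8 := Finset.sum_nonneg fun i (_ : i ∈ Finset.range a) =>
    (n0 _ _ _ (h01 (y - b - i)) (h01 (y - b - i + b)) (h01 (y - b - i + a + b))).2.1
  generalize (∑ i ∈ Finset.range (2 * a + b),
    onlyFirst (f (y - i)) (f (y - i + a)) (f (y - i + a + b))) = t1 at *
  generalize (∑ i ∈ Finset.range b,
    onlyFirst (f (y - i + a)) (f (y - i)) (f (y - i + a + b))) = t2 at *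
  generalize (∑ i ∈ Finset.range (2 * a),
    f (y - b - i) * f (y - b - i + a) * f (y - b - i + a + b)) = t3 at *
  generalize (∑ i ∈ Finset.range b,
    mono (f (y - i)) (f (y - i + b)) (f (y - i + a + b))) = t4 at *
  generalize (∑ i ∈ Finset.range a,
    onlyFirst (f (y - i + a)) (f (y - i)) (f (y - i + a + b))) = t5 at *
  generalize (∑ i ∈ Finset.range (a + 2 * b),
    onlyFirst (f (y + b - i + a + b)) (f (y + b - i)) (f (y + b - i + a))) = t6 at *
  generalize (∑ i ∈ Finset.range (2 * b),
    f (y + b - i) * f (y + b - i + a) * f (y + b - i + a + b)) = t7 at *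
  generalize (∑ i ∈ Finset.range a,
    mono (f (y - b - i)) (f (y - b - i + b)) (f (y - b - i + a + b))) = t8 at *
  have key : (t1 + t2 + t3 + t4 + 2 * (t5 + t6 + t7 + t8)) % 3 = 1 := by
    simp only [GB, GD] at s1 s2 s3 s4 s5 s6 s7 s8
    rw [s1, s2, s3, s4, s5, s6, s7, s8]
    push_cast
    clear * - hab
    ring_nf
    omega
  omega


theorem sum_sum_range_sub {N : ℕ} [NeZero N] (g : ZMod N → ℤ) (d : ZMod N) (c : ℕ) :
    ∑ y, ∑ i ∈ Finset.range c, g (y + d - i) = c * ∑ x, g x := by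
  rw [Finset.sum_comm]
  have h : ∀ i ∈ Finset.range c, ∑ y, g (y + d - i) = ∑ x, g x := fun i _ => by
    simpa [add_sub_assoc] using Equiv.sum_comp (Equiv.addRight (d - (i : ZMod N))) g
  rw [Finset.sum_congr rfl h]
  simp

theorem sum_add_right {N : ℕ} [NeZero N] (g : ZMod N → ℤ) (d : ZMod N) :
    ∑ x, g (x + d) = ∑ x, g x :=
  Equiv.sum_comp (Equiv.addRight d) g

theorem card_le_mul_excess {N : ℕ} [NeZero N] (f : ZMod N → ℤ) (a b : ℕ)
    (hab : ((a : ℤ) - b) % 3 = 1) (h01 : ∀ x, f x = 0 ∨ f x = 1)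
    (hit : ∀ x, 1 ≤ f x + f (x + a) + f (x + a + b)) :
    (N : ℤ) ≤ (2 * a + b) * (3 * ∑ x, f x - N) := by
  obtain ⟨A, hA⟩ : ∃ g : ZMod N → ℤ, ∀ x, g x = onlyFirst (f x) (f (x + a)) (f (x + a + b)) :=
    ⟨_, fun _ => rfl⟩
  obtain ⟨A', hA'⟩ : ∃ g : ZMod N → ℤ, ∀ x, g x = onlyFirst (f (x + a)) (f x) (f (x + a + b)) :=
    ⟨_, fun _ => rfl⟩
  obtain ⟨A'', hA''⟩ : ∃ g : ZMod N → ℤ, ∀ x, g x = onlyFirst (f (x + a + b)) (f x) (f (x + a)) :=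
    ⟨_, fun _ => rfl⟩
  obtain ⟨B, hB⟩ : ∃ g : ZMod N → ℤ, ∀ x, g x = f x * f (x + a) * f (x + a + b) :=
    ⟨_, fun _ => rfl⟩
  obtain ⟨D, hD⟩ : ∃ g : ZMod N → ℤ, ∀ x, g x = mono (f x) (f (x + b)) (f (x + a + b)) :=
    ⟨_, fun _ => rfl⟩
  have cut : ∀ y : ZMod N,
      2 ≤ 2 * (∑ i ∈ Finset.range (2 * a + b), A (y + 0 - i)
          + ∑ i ∈ Finset.range b, A' (y + 0 - i)
          + ∑ i ∈ Finset.range (2 * a), B (y + (-b) - i)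
          + ∑ i ∈ Finset.range b, D (y + 0 - i))
        + (∑ i ∈ Finset.range a, A' (y + 0 - i)
          + ∑ i ∈ Finset.range (a + 2 * b), A'' (y + b - i)
          + ∑ i ∈ Finset.range (2 * b), B (y + b - i)
          + ∑ i ∈ Finset.range a, D (y + (-b) - i)) := by
    intro y
    obtain ⟨z, rfl⟩ := ZMod.intCast_surjective y
    have := weighted_cut_bound (fun x : ℤ => f x) a b hab (fun x => h01 x)
      (fun x => by simpa using hit x) z
    simpa [hA, hA', hA'', hB, hD, sub_eq_add_neg] using this
  have total := Finset.sum_le_sum fun y (_ : y ∈ Finset.univ) => cut y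
  simp only [Finset.sum_add_distrib, ← Finset.mul_sum, sum_sum_range_sub] at total
  simp only [Finset.sum_const, Finset.card_univ, ZMod.card, nsmul_eq_mul] at total
  have hB' : ∀ x, B x = 1 - f x - f (x + a) - f (x + a + b)
      + f x * f (x + a) + f (x + a) * f (x + a + b) + f x * f (x + a + b) := by
    intro x
    have := hit x
    rw [hB]
    rcases h01 x with h | h <;> rcases h01 (x + a) with h' | h' <;>
      rcases h01 (x + a + b) with h'' | h'' <;> simp [h, h', h''] at this ⊢
  have nonneg : ∀ p q r : ℤ, (p = 0 ∨ p = 1) → (q = 0 ∨ q = 1) → (r = 0 ∨ r = 1) →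
      0 ≤ onlyFirst p q r ∧ 0 ≤ p * q * r := by
    rintro p q r (rfl | rfl) (rfl | rfl) (rfl | rfl) <;> simp [onlyFirst]
  have hmono : ∑ x, D x = ∑ x, B x := by
    have e1 := sum_add_right (fun x => f x * f (x + a)) (b : ZMod N)
    have e2 := sum_add_right (fun x => f x * f (x + b)) (a : ZMod N)
    have e3 := sum_add_right f (a : ZMod N)
    have e4 := sum_add_right f (b : ZMod N)
    have e5 : ∀ x : ZMod N, D x = B x + f (x + a) - f (x + b) + f x * f (x + b)
          + f (x + b) * f (x + b + a) - f x * f (x + a) - f (x + a) * f (x + a + b) := by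
      intro x
      rw [hB', hD, show x + (b : ZMod N) + a = x + a + b by ring]
      simp only [mono]
      ring
    simp only [e5, Finset.sum_add_distrib, Finset.sum_sub_distrib]
    linarith
  have hexcess : 3 * ∑ x, f x - N = ∑ x, A x + ∑ x, A' x + ∑ x, A'' x + 2 * ∑ x, B x := by
    have e1 := sum_add_right f (a : ZMod N)
    have e2 := sum_add_right f (a + b : ZMod N)
    simp only [← add_assoc] at e2
    have e3 : ∑ x : ZMod N, (f x + f (x + a) + f (x + a + b) - 1) = 3 * ∑ x, f x - N := by
      simp only [Finset.sum_sub_distrib, Finset.sum_add_distrib, e1, e2]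
      simp
      ring
    rw [← e3, Finset.mul_sum, ← Finset.sum_add_distrib, ← Finset.sum_add_distrib,
      ← Finset.sum_add_distrib]
    refine Finset.sum_congr rfl fun x _ => ?_
    rw [hA, hA', hA'']
    simp only [onlyFirst]
    linarith [hB x, hB' x]
  rw [hmono] at total
  rw [hexcess]
  have p1 : 0 ≤ ∑ x, A' x := Finset.sum_nonneg fun x _ => by
    rw [hA']; exact (nonneg _ _ _ (h01 _) (h01 _) (h01 _)).1
  have p2 : 0 ≤ ∑ x, A'' x := Finset.sum_nonneg fun x _ => by
    rw [hA'']; exact (nonneg _ _ _ (h01 _) (h01 _) (h01 _)).1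
  have p3 : 0 ≤ ∑ x, B x := Finset.sum_nonneg fun x _ => by
    rw [hB]; exact (nonneg _ _ _ (h01 _) (h01 _) (h01 _)).2
  have ha : (0 : ℤ) ≤ a := by positivity
  push_cast at total
  linarith [mul_nonneg ha p1, mul_nonneg ha p2, mul_nonneg ha p3]

theorem card_le_mul_excess_of_swap {N : ℕ} [NeZero N] (f : ZMod N → ℤ) (a b : ℕ)
    (hab : ((b : ℤ) - a) % 3 = 1) (h01 : ∀ x, f x = 0 ∨ f x = 1)
    (hit : ∀ x, 1 ≤ f x + f (x + a) + f (x + a + b)) :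
    (N : ℤ) ≤ (a + 2 * b) * (3 * ∑ x, f x - N) := by
  have := card_le_mul_excess (fun x => f (-x)) b a hab (fun x => h01 _) (fun x => by
    have := hit (-x - b - a)
    rw [show -x - (b : ZMod N) - a + a = -(x + b) by ring,
      show -(x + (b : ZMod N)) + b = -x by ring,
      show -x - (b : ZMod N) - a = -(x + b + a) by ring] at this
    linarith)
  rw [show ∑ x, f (-x) = ∑ x, f x from Equiv.sum_comp (Equiv.neg (ZMod N)) f] at this
  linarith

theorem card_le_three_mul_sum {N : ℕ} [NeZero N] (f : ZMod N → ℤ) (a b : ℕ)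
    (hit : ∀ x, 1 ≤ f x + f (x + a) + f (x + a + b)) : (N : ℤ) ≤ 3 * ∑ x, f x := by
  have e1 := sum_add_right f (a : ZMod N)
  have e2 := sum_add_right f (a + b : ZMod N)
  simp only [← add_assoc] at e2
  have := Finset.sum_le_sum fun x (_ : x ∈ Finset.univ) => hit x
  simp only [Finset.sum_add_distrib, e1, e2] at this
  simp at this
  linarith


theorem tendsto_add_div_two_mul_add_one (ρ C : ℝ) :
    Tendsto (fun n : ℕ => ρ + C / (2 * n + 1)) atTop (nhds ρ) := by
  have h : Tendsto (fun n : ℕ => 2 * (n : ℝ) + 1) atTop atTop :=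
    tendsto_atTop_add_const_right _ _ (tendsto_natCast_atTop_atTop.const_mul_atTop two_pos)
  simpa using tendsto_const_nhds.add (tendsto_const_nhds.div_atTop h)

theorem ncard_inter_Icc_le (A : Set ℤ) (n : ℕ) :
    (A ∩ Set.Icc (-(n : ℤ)) n).ncard ≤ 2 * n + 1 := by
  refine (Set.ncard_le_ncard Set.inter_subset_right (Set.finite_Icc _ _)).trans ?_
  rw [← Finset.coe_Icc, Set.ncard_coe_finset, Int.card_Icc]
  omega

theorem isBoundedUnder_density (A : Set ℤ) : IsBoundedUnder (· ≤ ·) atTop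
    fun n : ℕ => ((A ∩ Set.Icc (-(n : ℤ)) n).ncard : ℝ) / (2 * n + 1) :=
  isBoundedUnder_of ⟨1, fun n => by
    rw [div_le_one (by positivity)]
    exact_mod_cast ncard_inter_Icc_le A n⟩

theorem isCoboundedUnder_density (A : Set ℤ) : IsCoboundedUnder (· ≤ ·) atTop
    fun n : ℕ => ((A ∩ Set.Icc (-(n : ℤ)) n).ncard : ℝ) / (2 * n + 1) :=
  IsBoundedUnder.isCoboundedUnder_le (isBoundedUnder_of ⟨0, fun n => by positivity⟩)

theorem upperDensity_le_of_ncard_le {A : Set ℤ} {ρ C : ℝ}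
    (h : ∀ n : ℕ, ((A ∩ Set.Icc (-(n : ℤ)) n).ncard : ℝ) ≤ ρ * (2 * n + 1) + C) :
    upperDensity A ≤ ρ := by
  have lim := tendsto_add_div_two_mul_add_one ρ C
  rw [← lim.limsup_eq]
  refine limsup_le_limsup (Eventually.of_forall fun n => ?_) (isCoboundedUnder_density A)
    lim.isBoundedUnder_le
  have : (0 : ℝ) < 2 * n + 1 := by positivity
  simp only
  rw [div_le_iff₀ this, add_mul, div_mul_cancel₀ _ this.ne']
  exact h n

theorem le_upperDensity_of_le_ncard {A : Set ℤ} {ρ C : ℝ}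
    (h : ∀ n : ℕ, ρ * (2 * n + 1) + C ≤ ((A ∩ Set.Icc (-(n : ℤ)) n).ncard : ℝ)) :
    ρ ≤ upperDensity A := by
  have lim := tendsto_add_div_two_mul_add_one ρ C
  rw [← lim.limsup_eq]
  refine limsup_le_limsup (Eventually.of_forall fun n => ?_)
    lim.isCoboundedUnder_le (isBoundedUnder_density A)
  have : (0 : ℝ) < 2 * n + 1 := by positivity
  simp only
  rw [le_div_iff₀ this, add_mul, div_mul_cancel₀ _ this.ne']
  exact h n

/-- Indicator on `ZMod N` of the complement of the window `A ∩ [-n, n]`, shifted to `[0, 2n]`. -/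
theorem exists_blocking_indicator {A : Set ℤ} {a b : ℕ}
    (hA : SFree ({0, (a : ℤ), (a : ℤ) + b} : Set ℤ) A) (n : ℕ) :
    ∃ f : ZMod (2 * n + 1 + (a + b)) → ℤ, (∀ x, f x = 0 ∨ f x = 1) ∧
      (∀ x, 1 ≤ f x + f (x + a) + f (x + a + b)) ∧
      ∑ x, f x = (2 * n + 1 + (a + b) : ℕ) - ((A ∩ Set.Icc (-(n : ℤ)) n).ncard : ℤ) := by
  classical
  set N := 2 * n + 1 + (a + b) with hN
  have : NeZero N := ⟨by omega⟩
  let P : ZMod N → Prop := fun x => x.val < 2 * n + 1 ∧ (x.val : ℤ) - n ∈ A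
  have val_add : ∀ (x : ZMod N) (c : ℕ), x.val + c < N → (x + c).val = x.val + c := by
    intro x c h
    have hc : (c : ZMod N).val = c := ZMod.val_cast_of_lt (by omega)
    rw [ZMod.val_add_of_lt (by rwa [hc]), hc]
  refine ⟨fun x => if P x then 0 else 1, fun x => by by_cases h : P x <;> simp [h], fun x => ?_, ?_⟩
  · by_contra hlt
    have h : P x ∧ P (x + a) ∧ P (x + a + b) := by
      by_cases h0 : P x <;> by_cases h1 : P (x + a) <;> by_cases h2 : P (x + a + b) <;>
        simp_all
    obtain ⟨⟨l0, m0⟩, ⟨-, m1⟩, ⟨-, m2⟩⟩ := h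
    rw [add_assoc, ← Nat.cast_add] at m2
    rw [val_add x a (by omega)] at m1
    rw [val_add x (a + b) (by omega)] at m2
    refine hA ((x.val : ℤ) - n) ?_
    rintro _ ⟨s, hs, rfl⟩
    simp only [Set.mem_insert_iff, Set.mem_singleton_iff] at hs
    rcases hs with rfl | rfl | rfl
    · simpa using m0
    · convert m1 using 1; push_cast; ring
    · convert m2 using 1; push_cast; ring
  · have e1 : ∑ x, (if P x then (0 : ℤ) else 1) = ∑ x, (1 - if P x then (1 : ℤ) else 0) :=
      Finset.sum_congr rfl fun x _ => by by_cases h : P x <;> simp [h]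
    rw [e1, Finset.sum_sub_distrib, Finset.sum_boole]
    have e2 : A ∩ Set.Icc (-(n : ℤ)) n
        = ((Finset.univ.filter P).image fun x : ZMod N => (x.val : ℤ) - n : Finset ℤ) := by
      ext z
      simp only [Set.mem_inter_iff, Set.mem_Icc, Finset.coe_image, Finset.coe_filter,
        Finset.mem_univ, true_and, Set.mem_image, Set.mem_ofPred_eq, P]
      constructor
      · rintro ⟨hz, h1, h2⟩
        have hv : (((z + n).toNat : ℕ) : ZMod N).val = (z + n).toNat :=
          ZMod.val_cast_of_lt (by omega)
        refine ⟨((z + n).toNat : ℕ), ⟨?_, ?_⟩, ?_⟩ <;> rw [hv]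
        · omega
        · rwa [Int.toNat_of_nonneg (by omega), add_sub_cancel_right]
        · omega
      · rintro ⟨x, ⟨h1, h2⟩, rfl⟩
        exact ⟨h2, by omega, by omega⟩
    rw [e2, Set.ncard_coe_finset, Finset.card_image_of_injective]
    · simp [ZMod.card, hN]
    · intro x y hxy
      have h : (x.val : ℤ) - n = (y.val : ℤ) - n := hxy
      exact ZMod.val_injective N (by omega)

theorem upperDensity_le_of_mul_ncard_le {A : Set ℤ} {m k c : ℕ} (hm : 0 < m)
    (h : ∀ n : ℕ, m * (A ∩ Set.Icc (-(n : ℤ)) n).ncard ≤ k * (2 * n + 1 + c)) :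
    upperDensity A ≤ (k : ℝ) / m := by
  refine upperDensity_le_of_ncard_le (C := (k : ℝ) / m * c) fun n => ?_
  have h' : (m : ℝ) * (A ∩ Set.Icc (-(n : ℤ)) n).ncard ≤ k * (2 * n + 1 + c) := by
    exact_mod_cast h n
  rw [← mul_add, div_mul_eq_mul_div, le_div_iff₀ (by exact_mod_cast hm)]
  linarith

theorem upperDensity_le_or_of_sFree {A : Set ℤ} {a b : ℕ} (ha : 0 < a)
    (hA : SFree ({0, (a : ℤ), (a : ℤ) + b} : Set ℤ) A) :
    upperDensity A ≤ ((2 * (a + 2 * b) / 3 : ℕ) : ℝ) / (a + 2 * b : ℕ) ∨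
      upperDensity A ≤ ((2 * (2 * a + b) / 3 : ℕ) : ℝ) / (2 * a + b : ℕ) := by
  rcases (by omega : (((a : ℤ) - b) % 3 = 1) ∨ (((b : ℤ) - a) % 3 = 1) ∨ ((a : ℤ) - b) % 3 = 0)
    with h | h | h
  · right
    refine upperDensity_le_of_mul_ncard_le (c := a + b) (by omega) fun n => ?_
    have : NeZero (2 * n + 1 + (a + b)) := ⟨by omega⟩
    obtain ⟨f, h01, hit, hsum⟩ := exists_blocking_indicator hA n
    have key := card_le_mul_excess f a b h h01 hit
    rw [hsum] at key
    generalize (A ∩ Set.Icc (-(n : ℤ)) n).ncard = t at key ⊢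
    obtain ⟨k, hk⟩ : ∃ k, 2 * (2 * a + b) = 3 * k + 1 := ⟨2 * (2 * a + b) / 3, by omega⟩
    rw [show 2 * (2 * a + b) / 3 = k by omega]
    zify at hk ⊢
    push_cast at key
    nlinarith
  · left
    refine upperDensity_le_of_mul_ncard_le (c := a + b) (by omega) fun n => ?_
    have : NeZero (2 * n + 1 + (a + b)) := ⟨by omega⟩
    obtain ⟨f, h01, hit, hsum⟩ := exists_blocking_indicator hA n
    have key := card_le_mul_excess_of_swap f a b h h01 hit
    rw [hsum] at key
    generalize (A ∩ Set.Icc (-(n : ℤ)) n).ncard = t at key ⊢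
    obtain ⟨k, hk⟩ : ∃ k, 2 * (a + 2 * b) = 3 * k + 1 := ⟨2 * (a + 2 * b) / 3, by omega⟩
    rw [show 2 * (a + 2 * b) / 3 = k by omega]
    zify at hk ⊢
    push_cast at key
    nlinarith
  · left
    refine upperDensity_le_of_mul_ncard_le (c := a + b) (by omega) fun n => ?_
    have : NeZero (2 * n + 1 + (a + b)) := ⟨by omega⟩
    obtain ⟨f, h01, hit, hsum⟩ := exists_blocking_indicator hA n
    have key := card_le_three_mul_sum f a b hit
    rw [hsum] at key
    generalize (A ∩ Set.Icc (-(n : ℤ)) n).ncard = t at key ⊢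
    obtain ⟨k, hk⟩ : ∃ k, a + 2 * b = 3 * k := ⟨(a + 2 * b) / 3, by omega⟩
    rw [hk, show 2 * (3 * k) / 3 = 2 * k by omega]
    zify
    push_cast at key
    nlinarith

theorem card_div_le_upperDensity {m : ℕ} [NeZero m] (Q : Finset (ZMod m)) :
    (Q.card : ℝ) / m ≤ upperDensity {x : ℤ | (x : ZMod m) ∈ Q} := by
  have hm : 0 < m := Nat.pos_of_ne_zero (NeZero.ne m)
  refine le_upperDensity_of_le_ncard (C := -Q.card) fun n => ?_
  set t := (2 * n + 1) / m with ht
  have hcount : Q.card * t ≤ ({x : ℤ | (x : ZMod m) ∈ Q} ∩ Set.Icc (-(n : ℤ)) n).ncard := by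
    let g : ZMod m × ℕ → ℤ := fun p => ((p.1 + n : ZMod m).val + m * p.2 : ℕ) - (n : ℤ)
    have ginj : Function.Injective g := by
      rintro ⟨p, i⟩ ⟨q, j⟩ h
      have h' : (p + n : ZMod m).val + m * i = (q + n : ZMod m).val + m * j := by
        have : (((p + n : ZMod m).val + m * i : ℕ) : ℤ) - n
          = (((q + n : ZMod m).val + m * j : ℕ) : ℤ) - n := h
        omega
      have e1 := congrArg (· % m) h'
      have e2 := congrArg (· / m) h'
      simp only [Nat.add_mul_mod_self_left, Nat.mod_eq_of_lt (ZMod.val_lt _)] at e1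
      simp only [Nat.add_mul_div_left _ _ hm, Nat.div_eq_of_lt (ZMod.val_lt _), zero_add] at e2
      have := ZMod.val_injective m e1
      simp_all
    have hsub : (((Q ×ˢ Finset.range t).image g : Finset ℤ) : Set ℤ) ⊆
        {x : ℤ | (x : ZMod m) ∈ Q} ∩ Set.Icc (-(n : ℤ)) n := by
      intro z hz
      simp only [Finset.coe_image, Set.mem_image, Finset.mem_coe, Finset.mem_product,
        Finset.mem_range] at hz
      obtain ⟨⟨p, i⟩, ⟨hp, hi⟩, rfl⟩ := hz
      have hlt := ZMod.val_lt (p + n : ZMod m)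
      have hle : m * (i + 1) ≤ 2 * n + 1 :=
        (Nat.mul_le_mul_left m hi).trans (Nat.mul_div_le _ _)
      rw [mul_add, mul_one] at hle
      refine ⟨?_, ?_, ?_⟩
      · simpa [g] using hp
      · simp only [g]; omega
      · simp only [g]; omega
    have := Set.ncard_le_ncard hsub ((Set.finite_Icc _ _).subset Set.inter_subset_right)
    rwa [Set.ncard_coe_finset, Finset.card_image_of_injective _ ginj, Finset.card_product,
      Finset.card_range] at this
  have ht' : ((2 : ℝ) * n + 1) / m ≤ t + 1 := by
    rw [div_le_iff₀ (by exact_mod_cast hm)]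
    have : 2 * n + 1 < m * (t + 1) := Nat.lt_mul_div_succ _ hm
    have : ((2 : ℝ) * n + 1) < m * (t + 1) := by exact_mod_cast this
    linarith
  have hcount' : (Q.card : ℝ) * t ≤
      ({x : ℤ | (x : ZMod m) ∈ Q} ∩ Set.Icc (-(n : ℤ)) n).ncard := by exact_mod_cast hcount
  have := mul_le_mul_of_nonneg_left ht' (Nat.cast_nonneg (α := ℝ) Q.card)
  rw [mul_add, ← mul_div_assoc] at this
  rw [div_mul_eq_mul_div]
  linarith

/-- Residues modulo `m` other than `m - 1` whose representative is not `2` modulo `3`. -/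
def sparseResidues (m : ℕ) [NeZero m] : Finset (ZMod m) :=
  Finset.univ.filter fun j => j.val % 3 ≠ 2 ∧ j.val ≠ m - 1

theorem card_filter_range_mod_three_ne_two (n : ℕ) :
    ((Finset.range n).filter fun j => j % 3 ≠ 2).card = (2 * n + 2) / 3 := by
  induction n with
  | zero => simp
  | succ k ih =>
    rw [Finset.range_add_one, Finset.filter_insert]
    split_ifs with h
    · rw [Finset.card_insert_of_notMem (by simp), ih]
      rcases (by omega : k % 3 = 0 ∨ k % 3 = 1) with h | h <;> omega
    · rw [ih]
      omega

theorem card_sparseResidues (m : ℕ) [NeZero m] : (sparseResidues m).card = 2 * m / 3 := by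
  have hm : 0 < m := Nat.pos_of_ne_zero (NeZero.ne m)
  rw [show 2 * m / 3 = (2 * (m - 1) + 2) / 3 by congr 1; omega,
    ← card_filter_range_mod_three_ne_two, ← Finset.card_image_of_injective _ (ZMod.val_injective m)]
  congr 1
  ext j
  simp only [sparseResidues, Finset.mem_image, Finset.mem_filter, Finset.mem_univ, true_and,
    Finset.mem_range]
  constructor
  · rintro ⟨x, ⟨h1, h2⟩, rfl⟩
    have := ZMod.val_lt x
    exact ⟨by omega, h1⟩
  · rintro ⟨h1, h2⟩
    have : (j : ZMod m).val = j := ZMod.val_cast_of_lt (by omega)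
    exact ⟨j, by rw [this]; omega, this⟩

theorem not_three_consecutive_mem_sparseResidues {m : ℕ} [NeZero m] (hm : 1 < m) (j : ZMod m)
    (h0 : j ∈ sparseResidues m) (h1 : j + 1 ∈ sparseResidues m) (h2 : j + 2 ∈ sparseResidues m) :
    False := by
  have succ : ∀ x : ZMod m, x ∈ sparseResidues m → (x + 1).val = x.val + 1 := by
    intro x hx
    have : Fact (1 < m) := ⟨hm⟩
    have h := ZMod.val_lt x
    have := (Finset.mem_filter.mp hx).2.2
    rw [ZMod.val_add_of_lt (by rw [ZMod.val_one]; omega), ZMod.val_one]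
  have e1 := succ j h0
  have e2 := succ _ h1
  rw [add_assoc, one_add_one_eq_two] at e2
  have m0 := (Finset.mem_filter.mp h0).2.1
  have m1 := (Finset.mem_filter.mp h1).2.1
  have m2 := (Finset.mem_filter.mp h2).2.1
  omega

/-- A dilate by `u` that turns `{0, a, a + b}` into three consecutive residues yields a set free of
both `{0, a, a + b}` and its reflection. -/
theorem exists_sFree_of_dilate {a b m : ℕ} (hm : 1 < m) (u v : ZMod m) (huv : u * v = 1)
    (h : (u * a = -2 ∧ u * (a + b) = -1) ∨ (u * a = 1 ∧ u * (a + b) = -1)) :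
    ∃ A : Set ℤ, SFree ({0, (a : ℤ), (a : ℤ) + b} : Set ℤ) A ∧
      SFree (-({0, (a : ℤ), (a : ℤ) + b} : Set ℤ)) A ∧
      ((2 * m / 3 : ℕ) : ℝ) / m ≤ upperDensity A := by
  have : NeZero m := ⟨by omega⟩
  let Q : Finset (ZMod m) := (sparseResidues m).image (v * ·)
  have memQ : ∀ x, x ∈ Q → u * x ∈ sparseResidues m := by
    intro x hx
    obtain ⟨y, hy, rfl⟩ := Finset.mem_image.mp hx
    rwa [← mul_assoc, huv, one_mul]
  have cardQ : Q.card = 2 * m / 3 := by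
    rw [← card_sparseResidues, Finset.card_image_of_injective]
    intro x y hxy
    have : u * (v * x) = u * (v * y) := congrArg (u * ·) hxy
    rwa [← mul_assoc, ← mul_assoc, huv, one_mul, one_mul] at this
  refine ⟨{x : ℤ | (x : ZMod m) ∈ Q}, fun t ht => ?_, fun t ht => ?_,
    cardQ ▸ card_div_le_upperDensity Q⟩
  · have h0 := memQ _ (ht ⟨0, by simp, rfl⟩)
    have h1 := memQ _ (ht ⟨a, by simp, rfl⟩)
    have h2 := memQ _ (ht ⟨a + b, by simp, rfl⟩)
    push_cast at h0 h1 h2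
    rw [mul_add] at h0 h1 h2
    rcases h with ⟨e1, e2⟩ | ⟨e1, e2⟩ <;> rw [e1] at h1 <;> rw [e2] at h2
    · exact not_three_consecutive_mem_sparseResidues hm (u * t - 2) (by convert h1 using 1; ring)
        (by convert h2 using 1; ring) (by convert h0 using 1; ring)
    · exact not_three_consecutive_mem_sparseResidues hm (u * t - 1) (by convert h2 using 1; ring)
        (by convert h0 using 1; ring) (by convert h1 using 1; ring)
  · have h0 := memQ _ (ht ⟨0, by simp, rfl⟩)
    have h1 := memQ _ (ht ⟨-a, by simp, rfl⟩)
    have h2 := memQ _ (ht ⟨-(a + b), by simp, rfl⟩)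
    push_cast at h0 h1 h2
    rw [mul_add] at h0 h1 h2
    rw [mul_neg] at h1 h2
    rcases h with ⟨e1, e2⟩ | ⟨e1, e2⟩ <;> rw [e1] at h1 <;> rw [e2] at h2
    · exact not_three_consecutive_mem_sparseResidues hm (u * t) (by convert h0 using 1; ring)
        (by convert h2 using 1; ring) (by convert h1 using 1; ring)
    · exact not_three_consecutive_mem_sparseResidues hm (u * t - 1) (by convert h1 using 1; ring)
        (by convert h0 using 1; ring) (by convert h2 using 1; ring)

theorem exists_sFree_left {a b : ℕ} (ha : 0 < a) (hb : 0 < b) (hab : a.Coprime b) :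
    ∃ A : Set ℤ, SFree ({0, (a : ℤ), (a : ℤ) + b} : Set ℤ) A ∧
      SFree (-({0, (a : ℤ), (a : ℤ) + b} : Set ℤ)) A ∧
      ((2 * (a + 2 * b) / 3 : ℕ) : ℝ) / (a + 2 * b : ℕ) ≤ upperDensity A := by
  have hcop : b.Coprime (a + 2 * b) := by
    simpa using hab.symm
  have hu := (mul_comm _ _).trans (ZMod.coe_mul_inv_eq_one b hcop)
  have h0 : (a : ZMod (a + 2 * b)) + 2 * b = 0 := by
    exact_mod_cast ZMod.natCast_self (a + 2 * b)
  refine exists_sFree_of_dilate (by omega) (b : ZMod (a + 2 * b))⁻¹ b hu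
    (Or.inl ⟨?_, ?_⟩)
  · linear_combination (b : ZMod (a + 2 * b))⁻¹ * h0 - 2 * hu
  · linear_combination (b : ZMod (a + 2 * b))⁻¹ * h0 - hu

theorem exists_sFree_right {a b : ℕ} (ha : 0 < a) (hb : 0 < b) (hab : a.Coprime b) :
    ∃ A : Set ℤ, SFree ({0, (a : ℤ), (a : ℤ) + b} : Set ℤ) A ∧
      SFree (-({0, (a : ℤ), (a : ℤ) + b} : Set ℤ)) A ∧
      ((2 * (2 * a + b) / 3 : ℕ) : ℝ) / (2 * a + b : ℕ) ≤ upperDensity A := by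
  have hcop : a.Coprime (2 * a + b) := by
    simpa using hab
  have hu := (mul_comm _ _).trans (ZMod.coe_mul_inv_eq_one a hcop)
  have h0 : 2 * (a : ZMod (2 * a + b)) + b = 0 := by
    exact_mod_cast ZMod.natCast_self (2 * a + b)
  refine exists_sFree_of_dilate (by omega) (a : ZMod (2 * a + b))⁻¹ a hu
    (Or.inr ⟨hu, ?_⟩)
  linear_combination (a : ZMod (2 * a + b))⁻¹ * h0 - hu

theorem floor_two_thirds_mul (m : ℕ) : ⌊(2 : ℝ) / 3 * m⌋ = ((2 * m / 3 : ℕ) : ℤ) := by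
  rw [Int.floor_eq_iff]
  have h1 : (3 : ℝ) * (2 * m / 3 : ℕ) ≤ 2 * m := by exact_mod_cast Nat.mul_div_le (2 * m) 3
  have h2 : (2 * m : ℝ) < 3 * ((2 * m / 3 : ℕ) + 1) := by
    exact_mod_cast Nat.lt_mul_div_succ (2 * m) (by norm_num : 0 < 3)
  constructor <;> rw [Int.cast_natCast] <;> linarith

theorem stmt9 (l1 l2 : ℤ) (h1 : 0 < l1) (h2 : 0 < l2) (hco : Int.gcd l1 l2 = 1) :
    dF2 ({0, l1, l1 + l2} : Set ℤ) = dF ({0, l1, l1 + l2} : Set ℤ) ∧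
    dF ({0, l1, l1 + l2} : Set ℤ) =
      max ((⌊(2 : ℝ) / 3 * (l1 + 2 * l2)⌋ : ℝ) / (l1 + 2 * l2))
        ((⌊(2 : ℝ) / 3 * (2 * l1 + l2)⌋ : ℝ) / (2 * l1 + l2)) := by
  lift l1 to ℕ using h1.le with a
  lift l2 to ℕ using h2.le with b
  have ha : 0 < a := by exact_mod_cast h1
  have hb : 0 < b := by exact_mod_cast h2
  have hab : a.Coprime b := by simpa using hco
  have f1 := floor_two_thirds_mul (a + 2 * b)
  have f2 := floor_two_thirds_mul (2 * a + b)
  obtain ⟨A, hA1, hA2, hA⟩ := exists_sFree_left ha hb hab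
  obtain ⟨B, hB1, hB2, hB⟩ := exists_sFree_right ha hb hab
  have hle := fun X (hX : SFree ({0, (a : ℤ), (a : ℤ) + b} : Set ℤ) X) =>
    le_max_iff.mpr (upperDensity_le_or_of_sFree ha hX)
  have hmax : max ((⌊(2 : ℝ) / 3 * ((a : ℤ) + 2 * (b : ℤ))⌋ : ℝ) / ((a : ℤ) + 2 * (b : ℤ)))
        ((⌊(2 : ℝ) / 3 * (2 * (a : ℤ) + (b : ℤ))⌋ : ℝ) / (2 * (a : ℤ) + (b : ℤ))) =
      max (((2 * (a + 2 * b) / 3 : ℕ) : ℝ) / (a + 2 * b : ℕ))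
        (((2 * (2 * a + b) / 3 : ℕ) : ℝ) / (2 * a + b : ℕ)) := by
    rw [← Int.cast_natCast (2 * (a + 2 * b) / 3), ← Int.cast_natCast (2 * (2 * a + b) / 3),
      ← f1, ← f2]
    push_cast
    rfl
  rw [hmax]
  have e1 : dF ({0, (a : ℤ), (a : ℤ) + b} : Set ℤ) =
      max (((2 * (a + 2 * b) / 3 : ℕ) : ℝ) / (a + 2 * b : ℕ))
        (((2 * (2 * a + b) / 3 : ℕ) : ℝ) / (2 * a + b : ℕ)) := by
    have bdd : ∀ y ∈ upperDensity '' {X | SFree ({0, (a : ℤ), (a : ℤ) + b} : Set ℤ) X}, y ≤ _ :=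
      Set.forall_mem_image.mpr hle
    exact le_antisymm (csSup_le ⟨_, A, hA1, rfl⟩ bdd)
      (max_le (hA.trans (le_csSup ⟨_, bdd⟩ ⟨A, hA1, rfl⟩))
        (hB.trans (le_csSup ⟨_, bdd⟩ ⟨B, hB1, rfl⟩)))
  have e2 : dF2 ({0, (a : ℤ), (a : ℤ) + b} : Set ℤ) =
      max (((2 * (a + 2 * b) / 3 : ℕ) : ℝ) / (a + 2 * b : ℕ))
        (((2 * (2 * a + b) / 3 : ℕ) : ℝ) / (2 * a + b : ℕ)) := by
    have bdd : ∀ y ∈ upperDensity '' {X | SFree ({0, (a : ℤ), (a : ℤ) + b} : Set ℤ) X ∧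
        SFree (-({0, (a : ℤ), (a : ℤ) + b} : Set ℤ)) X}, y ≤ _ :=
      Set.forall_mem_image.mpr fun X hX => hle X hX.1
    exact le_antisymm (csSup_le ⟨_, A, ⟨hA1, hA2⟩, rfl⟩ bdd)
      (max_le (hA.trans (le_csSup ⟨_, bdd⟩ ⟨A, ⟨hA1, hA2⟩, rfl⟩))
        (hB.trans (le_csSup ⟨_, bdd⟩ ⟨B, ⟨hB1, hB2⟩, rfl⟩)))
  exact ⟨e2.trans e1.symm, e1⟩
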